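/- arXiv:1401.6483 — 9 statements merged into one kernel-verified Lean document; each statement's English description precedes it below -/
import Mathlib

section
/- Every extreme point δ of the collection polytope P has at most one split index, i.e. the set {i : Fin n | 0 < δ i ∧ δ i < d i} has at most one element; moreover, if some index i satisfies 0 < δ i < d i, then ∑ i, δ i = Q. -/
/-- An extreme point is not the midpoint of a nondegenerate segment in the set. -/
theorem eq_zero_of_add_mem_of_sub_mem_of_mem_extremePoints {E : Type*} [AddCommGroup E]
    [Module ℝ E] {A : Set E} {x v : E} (hx : x ∈ Set.extremePoints ℝ A)
    (hadd : x + v ∈ A) (hsub : x - v ∈ A) : v = 0 := by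
  have hmem : x ∈ openSegment ℝ (x + v) (x - v) :=
    ⟨1 / 2, 1 / 2, by norm_num, by norm_num, by norm_num, by module⟩
  simpa using (mem_extremePoints.1 hx).2 _ hadd _ hsub hmem

/-- Every extreme point `δ` of the collection polytope
`P = {δ | ∑ i, δ i ≤ Q ∧ ∀ i, 0 ≤ δ i ∧ δ i ≤ d i}` has at most one split index,
and if some index is split then `∑ i, δ i = Q`. -/
theorem stmt_0 (n : ℕ) (Q : ℝ) (hQ : 0 < Q) (d : Fin n → ℝ) (hd : ∀ i, 0 < d i)
    (P : Set (Fin n → ℝ))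
    (hP : P = {δ : Fin n → ℝ | (∑ i, δ i) ≤ Q ∧ ∀ i, 0 ≤ δ i ∧ δ i ≤ d i})
    (δ : Fin n → ℝ) (hδ : δ ∈ Set.extremePoints ℝ P) :
    {i : Fin n | 0 < δ i ∧ δ i < d i}.Subsingleton ∧
      ((∃ i, 0 < δ i ∧ δ i < d i) → ∑ i, δ i = Q) := by
  subst hP
  obtain ⟨hsum, hbox⟩ := hδ.1
  refine ⟨fun i hi j hj => ?_, ?_⟩
  · by_contra hij
    obtain ⟨hi₀, hi₁⟩ := hi
    obtain ⟨hj₀, hj₁⟩ := hj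
    obtain ⟨ε, hε, hε'⟩ : ∃ ε > 0, ε < min (min (δ i) (d i - δ i)) (min (δ j) (d j - δ j)) :=
      exists_between (by simp [*])
    simp only [lt_min_iff] at hε'
    obtain ⟨⟨h₁, h₂⟩, h₃, h₄⟩ := hε'
    have hv : (Pi.single i ε - Pi.single j ε : Fin n → ℝ) = 0 := by
      refine eq_zero_of_add_mem_of_sub_mem_of_mem_extremePoints hδ
        ⟨?_, fun k => ?_⟩ ⟨?_, fun k => ?_⟩
      · simpa [Finset.sum_add_distrib] using hsum
      · have := hbox k
        simp only [Pi.add_apply, Pi.sub_apply, Pi.single_apply]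
        split_ifs <;> subst_vars <;> constructor <;> linarith
      · simpa [Finset.sum_sub_distrib] using hsum
      · have := hbox k
        simp only [Pi.sub_apply, Pi.single_apply]
        split_ifs <;> subst_vars <;> constructor <;> linarith
    have := congrFun hv i
    simp [hij, hε.ne'] at this
  · rintro ⟨i, hi₀, hi₁⟩
    by_contra hne
    have hlt : ∑ k, δ k < Q := lt_of_le_of_ne hsum hne
    obtain ⟨ε, hε, hε'⟩ : ∃ ε > 0, ε < min (min (δ i) (d i - δ i)) (Q - ∑ k, δ k) :=
      exists_between (by simp [*])
    simp only [lt_min_iff] at hε'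
    obtain ⟨⟨h₁, h₂⟩, h₃⟩ := hε'
    have hv : (Pi.single i ε : Fin n → ℝ) = 0 := by
      refine eq_zero_of_add_mem_of_sub_mem_of_mem_extremePoints hδ
        ⟨?_, fun k => ?_⟩ ⟨?_, fun k => ?_⟩
      · simp only [Pi.add_apply, Finset.sum_add_distrib, Fintype.sum_pi_single']
        linarith
      · have := hbox k
        simp only [Pi.add_apply, Pi.single_apply]
        split_ifs <;> subst_vars <;> constructor <;> linarith
      · simp only [Pi.sub_apply, Finset.sum_sub_distrib, Fintype.sum_pi_single']
        linarith
      · have := hbox k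
        simp only [Pi.sub_apply, Pi.single_apply]
        split_ifs <;> subst_vars <;> constructor <;> linarith
    exact hε.ne' (Pi.single_eq_zero_iff.1 hv)
end

section
/- Let δ ∈ P be such that at most one index i satisfies 0 < δ i < d i, and such that whenever some index i satisfies 0 < δ i < d i one has ∑ i, δ i = Q. Then δ is an extreme point of P. -/
/-- If a convex combination with positive weights of two reals bounded above by `c` equals `c`,
then the first of them equals `c`. -/
theorem eq_of_convex_comb_eq_of_le {a b x y c : ℝ} (ha : 0 < a) (hb : 0 < b) (hab : a + b = 1)
    (hx : x ≤ c) (hy : y ≤ c) (h : a * x + b * y = c) : x = c := by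
  obtain rfl : b = 1 - a := by linarith
  refine le_antisymm hx ?_
  by_contra! hlt
  nlinarith [mul_lt_mul_of_pos_left hlt ha, mul_le_mul_of_nonneg_left hy hb.le]

/-- If `δ ∈ P` has at most one split index, and the presence of a split index forces
`∑ i, δ i = Q`, then `δ` is an extreme point of the collection polytope `P`. -/
theorem stmt_1 (n : ℕ) (Q : ℝ) (hQ : 0 < Q) (d : Fin n → ℝ) (hd : ∀ i, 0 < d i)
    (P : Set (Fin n → ℝ))
    (hP : P = {δ : Fin n → ℝ | (∑ i, δ i) ≤ Q ∧ ∀ i, 0 ≤ δ i ∧ δ i ≤ d i})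
    (δ : Fin n → ℝ) (hδP : δ ∈ P)
    (hsplit : {i : Fin n | 0 < δ i ∧ δ i < d i}.Subsingleton)
    (hsum : (∃ i, 0 < δ i ∧ δ i < d i) → ∑ i, δ i = Q) :
    δ ∈ Set.extremePoints ℝ P := by
  subst hP
  refine mem_extremePoints_iff_left.2 ⟨hδP, ?_⟩
  rintro x ⟨hxQ, hx⟩ y ⟨hyQ, hy⟩ ⟨a, b, ha, hb, hab, hδ⟩
  have hcomb (i) : a * x i + b * y i = δ i := by simpa using congrFun hδ i
  have hfix (i) (hi : ¬(0 < δ i ∧ δ i < d i)) : x i = δ i := by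
    rcases (hδP.2 i).1.eq_or_lt with h0 | h0
    · have := eq_of_convex_comb_eq_of_le (x := -x i) (y := -y i) (c := 0) ha hb hab
        (by linarith [hx i]) (by linarith [hy i]) (by linarith [hcomb i])
      linarith
    · have hdi : δ i = d i := (hδP.2 i).2.antisymm (not_lt.1 fun h => hi ⟨h0, h⟩)
      rw [hdi]
      exact eq_of_convex_comb_eq_of_le ha hb hab (hx i).2 (hy i).2 ((hcomb i).trans hdi)
  funext i
  by_cases hi : 0 < δ i ∧ δ i < d i
  · have hδQ := hsum ⟨i, hi⟩
    have hxs : ∑ j, x j = Q := by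
      refine eq_of_convex_comb_eq_of_le ha hb hab hxQ hyQ ?_
      rw [Finset.mul_sum, Finset.mul_sum, ← Finset.sum_add_distrib, ← hδQ]
      exact Finset.sum_congr rfl fun j _ => hcomb j
    have hdiff : ∑ j, (x j - δ j) = x i - δ i :=
      Fintype.sum_eq_single i fun j hj =>
        sub_eq_zero.2 (hfix j fun h => hj (hsplit h hi))
    rw [Finset.sum_sub_distrib] at hdiff
    linarith
  · exact hfix i hi
end

section
/- If 0 ≤ q̂ ≤ ∑ i, d i, then the greedy allocation δ* satisfies ∑ i, δ* i = q̂ and 0 ≤ δ* i ≤ d i for all i (so δ* ∈ S(q̂)), and δ* maximizes the profit: for every δ ∈ S(q̂) one has ∑ i, g i * δ i ≤ ∑ i, g i * δ* i. -/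
/-- Filling the capacities `c 0, c 1, …` greedily with a total amount `q ≥ 0` uses up
`min (∑ k, c k) q`. -/
theorem sum_greedy_eq_min {n : ℕ} (c : Fin n → ℝ) (hc : ∀ k, 0 ≤ c k) {q : ℝ} (hq : 0 ≤ q) :
    ∑ k, min (c k) (max 0 (q - ∑ j ∈ Finset.Iio k, c j)) = min (∑ k, c k) q := by
  induction n with
  | zero => simp [hq]
  | succ n ih =>
    have hlast : ∑ j ∈ Finset.Iio (Fin.last n), c j = ∑ k : Fin n, c k.castSucc := by
      simp [Fin.Iio_last_eq_map]
    have hcast (k : Fin n) :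
        ∑ j ∈ Finset.Iio k.castSucc, c j = ∑ j ∈ Finset.Iio k, c j.castSucc := by
      simp [← Fin.map_castSuccEmb_Iio]
    rw [Fin.sum_univ_castSucc, Fin.sum_univ_castSucc, hlast]
    simp only [hcast]
    rw [ih (fun k => c k.castSucc) fun k => hc _]
    have := hc (Fin.last n)
    grind

/-- If every nonzero entry of `x` is at least as profitable as every unsaturated entry, then the
allocation `x` is optimal among the allocations with the same total and the same bounds. -/
theorem sum_mul_le_sum_mul_of_saturated {ι : Type*} [Fintype ι] {d g x y : ι → ℝ}
    (hx : ∀ i j, x i < d i → 0 < x j → g i ≤ g j) (hx0 : ∀ i, 0 ≤ x i) (hxd : ∀ i, x i ≤ d i)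
    (hy0 : ∀ i, 0 ≤ y i) (hyd : ∀ i, y i ≤ d i) (hsum : ∑ i, y i = ∑ i, x i) :
    ∑ i, g i * y i ≤ ∑ i, g i * x i := by
  obtain ⟨p, hlo, hhi⟩ : ∃ p, (∀ i, x i < d i → g i ≤ p) ∧ ∀ j, 0 < x j → p ≤ g j := by
    by_cases h : ∃ j, 0 < x j
    · obtain ⟨j, hj, hmin⟩ := (Finset.univ.filter fun j => 0 < x j).exists_min_image g
        (by simpa [Finset.filter_nonempty_iff] using h)
      simp only [Finset.mem_filter_univ] at hj hmin
      exact ⟨g j, fun i hi => hx i j hi hj, hmin⟩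
    · obtain ⟨p, hp⟩ := (Finset.univ.image g).exists_le
      exact ⟨p, fun i _ => hp _ (by simp), fun j hj => (h ⟨j, hj⟩).elim⟩
  have hterm (i : ι) : (g i - p) * y i ≤ (g i - p) * x i := by
    rcases lt_trichotomy (g i) p with h | h | h
    · have : x i = 0 := le_antisymm (not_lt.1 fun hi => (hhi i hi).not_gt h) (hx0 i)
      nlinarith [hy0 i]
    · simp [h]
    · have : x i = d i := le_antisymm (hxd i) (not_lt.1 fun hi => (hlo i hi).not_gt h)
      nlinarith [hyd i]
  have hle := Finset.sum_le_sum fun i (_ : i ∈ Finset.univ) => hterm i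
  simp only [sub_mul, Finset.sum_sub_distrib, ← Finset.mul_sum, hsum] at hle
  linarith


/-- If `0 ≤ q̂ ≤ ∑ i, d i`, the greedy allocation
`δ* (σ k) = min (d (σ k)) (max 0 (q̂ − ∑_{j < k} d (σ j)))` (with `σ` sorting profits
decreasingly) belongs to the slice `S(q̂)` and maximizes `∑ i, g i * δ i` over `S(q̂)`. -/
theorem stmt_4 (n : ℕ) (d : Fin n → ℝ) (hd : ∀ i, 0 < d i) (g : Fin n → ℝ)
    (σ : Equiv.Perm (Fin n)) (hσ : ∀ k l : Fin n, k ≤ l → g (σ l) ≤ g (σ k))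
    (qhat : ℝ) (hq0 : 0 ≤ qhat) (hqd : qhat ≤ ∑ i, d i)
    (δstar : Fin n → ℝ)
    (hδstar : ∀ k : Fin n,
      δstar (σ k) = min (d (σ k)) (max 0 (qhat - ∑ j ∈ Finset.Iio k, d (σ j)))) :
    (∑ i, δstar i = qhat) ∧ (∀ i, 0 ≤ δstar i ∧ δstar i ≤ d i) ∧
      (∀ δ : Fin n → ℝ, (∑ i, δ i = qhat ∧ ∀ i, 0 ≤ δ i ∧ δ i ≤ d i) →
        ∑ i, g i * δ i ≤ ∑ i, g i * δstar i) := by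
  have hsum : ∑ i, δstar i = qhat := by
    rw [← Equiv.sum_comp σ δstar]
    simp only [hδstar]
    rw [sum_greedy_eq_min (fun k => d (σ k)) (fun k => (hd _).le) hq0, Equiv.sum_comp σ d]
    exact min_eq_right hqd
  have hbd (i : Fin n) : 0 ≤ δstar i ∧ δstar i ≤ d i := by
    obtain ⟨k, rfl⟩ := σ.surjective i
    rw [hδstar]
    exact ⟨le_min (hd _).le (le_max_left _ _), min_le_left _ _⟩
  refine ⟨hsum, hbd, fun δ hδ => ?_⟩
  refine sum_mul_le_sum_mul_of_saturated ?_ (fun i => (hbd i).1) (fun i => (hbd i).2)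
    (fun i => (hδ.2 i).1) (fun i => (hδ.2 i).2) (hδ.1.trans hsum.symm)
  intro i j hi hj
  obtain ⟨k, rfl⟩ := σ.surjective i
  obtain ⟨l, rfl⟩ := σ.surjective j
  refine hσ l k (not_lt.1 fun hkl => ?_)
  rw [hδstar] at hi hj
  have hprefix : d (σ k) + ∑ j ∈ Finset.Iio k, d (σ j) ≤ ∑ j ∈ Finset.Iio l, d (σ j) := by
    rw [← Finset.sum_insert (f := fun j => d (σ j)) Finset.notMem_Iio_self]
    refine Finset.sum_le_sum_of_subset_of_nonneg ?_ fun _ _ _ => (hd _).le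
    intro m
    simp only [Finset.mem_insert, Finset.mem_Iio]
    rintro (rfl | hm)
    exacts [hkl, hm.trans hkl]
  grind
end

section
/- The greedy allocation δ* has at most one split index: the set {i : Fin n | 0 < δ* i ∧ δ* i < d i} has at most one element (so the collection pattern produced by the greedy procedure is an extreme collection pattern). -/
/-- In a greedy allocation, every item after one that is filled below its capacity
receives nothing. -/
theorem greedy_eq_zero_of_lt_capacity {n : ℕ} {c : Fin n → ℝ} (hc : ∀ i, 0 ≤ c i) {q : ℝ}
    {k l : Fin n} (hkl : k < l)
    (hk : min (c k) (max 0 (q - ∑ j ∈ Finset.Iio k, c j)) < c k) :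
    min (c l) (max 0 (q - ∑ j ∈ Finset.Iio l, c j)) = 0 := by
  have hlt : q - ∑ j ∈ Finset.Iio k, c j < c k := by
    rcases min_lt_iff.1 hk with h | h
    · exact absurd h (lt_irrefl _)
    · exact (le_max_right _ _).trans_lt h
  have hsum : c k + ∑ j ∈ Finset.Iio k, c j ≤ ∑ j ∈ Finset.Iio l, c j := by
    rw [← Finset.sum_insert (by simp)]
    refine Finset.sum_le_sum_of_subset_of_nonneg ?_ fun i _ _ => hc i
    intro j hj
    rcases Finset.mem_insert.1 hj with rfl | hj
    · exact Finset.mem_Iio.2 hkl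
    · exact Finset.mem_Iio.2 ((Finset.mem_Iio.1 hj).trans hkl)
  rw [max_eq_left (by linarith), min_eq_right (hc l)]

/-- The greedy allocation has at most one split index, i.e. the collection pattern
produced by the greedy procedure is an extreme collection pattern. -/
theorem stmt_5 (n : ℕ) (d : Fin n → ℝ) (hd : ∀ i, 0 < d i) (g : Fin n → ℝ)
    (σ : Equiv.Perm (Fin n)) (hσ : ∀ k l : Fin n, k ≤ l → g (σ l) ≤ g (σ k))
    (qhat : ℝ) (hq0 : 0 ≤ qhat) (hqd : qhat ≤ ∑ i, d i)
    (δstar : Fin n → ℝ)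
    (hδstar : ∀ k : Fin n,
      δstar (σ k) = min (d (σ k)) (max 0 (qhat - ∑ j ∈ Finset.Iio k, d (σ j)))) :
    {i : Fin n | 0 < δstar i ∧ δstar i < d i}.Subsingleton := by
  intro i hi i' hi'
  obtain ⟨k, rfl⟩ := σ.surjective i
  obtain ⟨l, rfl⟩ := σ.surjective i'
  simp only [Set.mem_ofPred_eq, hδstar] at hi hi'
  have hc : ∀ j, 0 ≤ d (σ j) := fun j => (hd (σ j)).le
  rcases lt_trichotomy k l with h | rfl | h
  · exact absurd (greedy_eq_zero_of_lt_capacity (c := d ∘ σ) hc h hi.2) hi'.1.ne'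
  · rfl
  · exact absurd (greedy_eq_zero_of_lt_capacity (c := d ∘ σ) hc h hi'.2) hi.1.ne'
end

section
/- Let k : Fin n and let q be a real number with ∑_{j < k} d (σ j) ≤ q ≤ ∑_{j ≤ k} d (σ j). Then the maximum of ∑ i, g i * δ i over δ ∈ S(q) equals ∑_{j < k} g (σ j) * d (σ j) + g (σ k) * (q − ∑_{j < k} d (σ j)). (In words: the value function of the continuous bounded knapsack is piecewise linear with breakpoints at the partial sums of the sorted capacities and slope g (σ k) on the k-th piece.) -/
/-- Exchange bound: if the weights `c` dominate `a` before `k` and are dominated by it from `k` on,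
then filling up every coordinate before `k` is optimal up to the linear term `a * ∑ x`. -/
theorem sum_mul_le_of_threshold {n : ℕ} {c u x : Fin n → ℝ} {a : ℝ} {k : Fin n}
    (hlt : ∀ j < k, a ≤ c j) (hge : ∀ j, k ≤ j → c j ≤ a)
    (hx : ∀ j, 0 ≤ x j ∧ x j ≤ u j) :
    ∑ j, c j * x j ≤
      ∑ j ∈ Finset.Iio k, c j * u j + a * (∑ j, x j - ∑ j ∈ Finset.Iio k, u j) := by
  have h : ∑ j, (c j - a) * x j ≤ ∑ j, if j < k then (c j - a) * u j else 0 := by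
    refine Finset.sum_le_sum fun j _ => ?_
    split_ifs with hj
    · exact mul_le_mul_of_nonneg_left (hx j).2 (sub_nonneg.2 (hlt j hj))
    · exact mul_nonpos_of_nonpos_of_nonneg (sub_nonpos.2 (hge j (not_lt.1 hj))) (hx j).1
  rw [← Finset.sum_filter, Finset.filter_gt_eq_Iio] at h
  simp only [sub_mul, Finset.sum_sub_distrib, ← Finset.mul_sum] at h
  linarith

/-- Summing a function that is `f` before `k`, `b` at `k` and zero afterwards. -/
theorem sum_ite_lt_ite_eq {n : ℕ} (f : Fin n → ℝ) (b : ℝ) (k : Fin n) :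
    (∑ j, if j < k then f j else if j = k then b else 0) = ∑ j ∈ Finset.Iio k, f j + b := by
  have h : ∀ j, (if j < k then f j else if j = k then b else 0) =
      (if j < k then f j else 0) + if j = k then b else 0 := by
    intro j
    split_ifs with h₁ h₂ <;> simp_all
  simp only [h, Finset.sum_add_distrib, ← Finset.sum_filter, Finset.filter_gt_eq_Iio,
    Finset.filter_eq', Finset.mem_univ, if_true, Finset.sum_singleton]


/-- On the `k`-th piece, i.e. for `∑_{j<k} d (σ j) ≤ q ≤ ∑_{j≤k} d (σ j)`, the maximum of
`∑ i, g i * δ i` over the slice `S(q)` equals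
`∑_{j<k} g (σ j) * d (σ j) + g (σ k) * (q − ∑_{j<k} d (σ j))`. -/
theorem stmt_6 (n : ℕ) (d : Fin n → ℝ) (hd : ∀ i, 0 < d i) (g : Fin n → ℝ)
    (σ : Equiv.Perm (Fin n)) (hσ : ∀ k l : Fin n, k ≤ l → g (σ l) ≤ g (σ k))
    (k : Fin n) (q : ℝ)
    (hq1 : ∑ j ∈ Finset.Iio k, d (σ j) ≤ q)
    (hq2 : q ≤ ∑ j ∈ Finset.Iic k, d (σ j)) :
    IsGreatest {v : ℝ | ∃ δ : Fin n → ℝ,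
        ((∑ i, δ i = q) ∧ ∀ i, 0 ≤ δ i ∧ δ i ≤ d i) ∧ v = ∑ i, g i * δ i}
      (∑ j ∈ Finset.Iio k, g (σ j) * d (σ j) +
        g (σ k) * (q - ∑ j ∈ Finset.Iio k, d (σ j))) := by
  have hq2' : q - ∑ j ∈ Finset.Iio k, d (σ j) ≤ d (σ k) := by
    rw [← Finset.Iio_insert, Finset.sum_insert (by simp)] at hq2
    linarith
  constructor
  · let x : Fin n → ℝ := fun j =>
      if j < k then d (σ j) else if j = k then q - ∑ j ∈ Finset.Iio k, d (σ j) else 0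
    have hx : ∀ j, 0 ≤ x j ∧ x j ≤ d (σ j) := by
      intro j
      have hj := (hd (σ j)).le
      dsimp only [x]
      split_ifs with h₁ h₂
      · exact ⟨hj, le_rfl⟩
      · subst h₂
        exact ⟨sub_nonneg.2 hq1, hq2'⟩
      · exact ⟨le_rfl, hj⟩
    refine ⟨fun i => x (σ.symm i), ⟨?_, fun i => by simpa using hx (σ.symm i)⟩, ?_⟩
    · rw [Equiv.sum_comp σ.symm x, sum_ite_lt_ite_eq]
      ring
    · rw [← Equiv.sum_comp σ, ← sum_ite_lt_ite_eq]
      refine Finset.sum_congr rfl fun j _ => ?_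
      simp only [Equiv.symm_apply_apply, x]
      split_ifs with h₁ h₂
      · rfl
      · rw [h₂]
      · rw [mul_zero]
  · rintro v ⟨δ, ⟨hsum, hδ⟩, rfl⟩
    rw [← hsum, ← Equiv.sum_comp σ δ, ← Equiv.sum_comp σ fun i => g i * δ i]
    exact sum_mul_le_of_threshold (fun j hj => hσ j k hj.le) (fun j hj => hσ k j hj)
      fun j => hδ (σ j)
end

section
/- Define V : ℝ → ℝ on the interval [0, ∑ i, d i] by V(q) = sSup {v | ∃ δ ∈ S(q), v = ∑ i, g i * δ i} (this supremum is attained since S(q) is nonempty and compact for q in this interval). Then V is concave on the interval [0, ∑ i, d i]. (Equivalently, the reduced cost function G(r, q) = f_r − V(q) of the paper is convex in the collected quantity q.) -/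
open scoped Pointwise

/-- The profits attainable by filling the bounded continuous knapsack to level `q`. -/
def knapsackProfits {n : ℕ} (d g : Fin n → ℝ) (q : ℝ) : Set ℝ :=
  {v : ℝ | ∃ δ : Fin n → ℝ,
    ((∑ i, δ i = q) ∧ ∀ i, 0 ≤ δ i ∧ δ i ≤ d i) ∧ v = ∑ i, g i * δ i}

theorem knapsackProfits_nonempty {n : ℕ} {d : Fin n → ℝ} (hd : ∀ i, 0 ≤ d i) (g : Fin n → ℝ)
    {q : ℝ} (hq : q ∈ Set.Icc (0 : ℝ) (∑ i, d i)) : (knapsackProfits d g q).Nonempty := by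
  obtain ⟨h0, h1⟩ := hq
  have hD : 0 ≤ ∑ i, d i := h0.trans h1
  refine ⟨_, fun i ↦ q / (∑ j, d j) * d i, ⟨?_, fun i ↦ ⟨?_, ?_⟩⟩, rfl⟩
  · rw [← Finset.mul_sum]
    exact div_mul_cancel_of_imp fun h ↦ le_antisymm (h ▸ h1) h0
  · exact mul_nonneg (div_nonneg h0 hD) (hd i)
  · exact mul_le_of_le_one_left (hd i) (div_le_one_of_le₀ h1 hD)

theorem bddAbove_knapsackProfits {n : ℕ} (d g : Fin n → ℝ) (q : ℝ) :
    BddAbove (knapsackProfits d g q) := by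
  refine ⟨∑ i, |g i| * d i, ?_⟩
  rintro _ ⟨δ, ⟨-, hδ⟩, rfl⟩
  exact Finset.sum_le_sum fun i _ ↦
    mul_le_mul (le_abs_self _) (hδ i).2 (hδ i).1 (abs_nonneg _)

theorem smul_add_smul_knapsackProfits_subset {n : ℕ} (d g : Fin n → ℝ) (x y : ℝ) {a b : ℝ}
    (ha : 0 ≤ a) (hb : 0 ≤ b) (hab : a + b = 1) :
    a • knapsackProfits d g x + b • knapsackProfits d g y ⊆
      knapsackProfits d g (a • x + b • y) := by
  rintro _ ⟨_, ⟨_, ⟨δ, ⟨rfl, hδ⟩, rfl⟩, rfl⟩, _, ⟨_, ⟨ε, ⟨rfl, hε⟩, rfl⟩, rfl⟩, rfl⟩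
  refine ⟨fun i ↦ a * δ i + b * ε i, ⟨?_, fun i ↦ ?_⟩, ?_⟩
  · simp only [Finset.sum_add_distrib, Finset.mul_sum, smul_eq_mul]
  · exact convex_Icc 0 (d i) (hδ i) (hε i) ha hb hab
  · simp only [smul_eq_mul, Finset.mul_sum, ← Finset.sum_add_distrib]
    exact Finset.sum_congr rfl fun i _ ↦ by ring


/-- The value function `V(q) = sSup {∑ i, g i * δ i | δ ∈ S(q)}` of the continuous
bounded knapsack is concave on `[0, ∑ i, d i]`. -/
theorem stmt_7 (n : ℕ) (d : Fin n → ℝ) (hd : ∀ i, 0 < d i) (g : Fin n → ℝ)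
    (V : ℝ → ℝ)
    (hV : ∀ q ∈ Set.Icc (0 : ℝ) (∑ i, d i),
      V q = sSup {v : ℝ | ∃ δ : Fin n → ℝ,
        ((∑ i, δ i = q) ∧ ∀ i, 0 ≤ δ i ∧ δ i ≤ d i) ∧ v = ∑ i, g i * δ i}) :
    ConcaveOn ℝ (Set.Icc (0 : ℝ) (∑ i, d i)) V := by
  refine ⟨convex_Icc _ _, fun x hx y hy a b ha hb hab ↦ ?_⟩
  have hne {q : ℝ} (hq : q ∈ Set.Icc (0 : ℝ) (∑ i, d i)) :=
    knapsackProfits_nonempty (fun i ↦ (hd i).le) g hq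
  have hbdd := bddAbove_knapsackProfits d g
  rw [hV x hx, hV y hy, hV _ (convex_Icc _ _ hx hy ha hb hab)]
  change a • sSup (knapsackProfits d g x) + b • sSup (knapsackProfits d g y) ≤
    sSup (knapsackProfits d g (a • x + b • y))
  rw [← Real.sSup_smul_of_nonneg ha, ← Real.sSup_smul_of_nonneg hb,
    ← csSup_add (hne hx).smul_set ((hbdd x).smul_of_nonneg ha)
      (hne hy).smul_set ((hbdd y).smul_of_nonneg hb)]
  exact csSup_le_csSup (hbdd _) ((hne hx).smul_set.add (hne hy).smul_set)
    (smul_add_smul_knapsackProfits_subset d g x y ha hb hab)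
end

section
/- Let Q ≥ 0, let C(Q) = {δ : Fin n → ℝ | (∑ i, δ i) ≤ Q ∧ ∀ i, 0 ≤ δ i ∧ δ i ≤ d i}, and for q ∈ [0, ∑ i, d i] let V(q) be the maximum of ∑ i, g i * δ i over S(q) = {δ | (∑ i, δ i) = q ∧ ∀ i, 0 ≤ δ i ∧ δ i ≤ d i}. Set q* = min Q (∑_{i : 0 < g i} d i). Then the maximum of ∑ i, g i * δ i over C(Q) equals V(q*). (In words: the minimum of the reduced cost function G(r, q) over q ∈ [0, Q] is attained at q* equal to the total demand of positive-profit vertices capped at Q.) -/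
/-- Between two ordered vectors there is one with any prescribed intermediate coordinate sum. -/
theorem exists_between_sum_eq {ι : Type*} [Fintype ι] {a b : ι → ℝ} (hab : ∀ i, a i ≤ b i)
    {q : ℝ} (haq : ∑ i, a i ≤ q) (hqb : q ≤ ∑ i, b i) :
    ∃ c : ι → ℝ, (∀ i, a i ≤ c i ∧ c i ≤ b i) ∧ ∑ i, c i = q := by
  have hq : q ∈ segment ℝ (∑ i, a i) (∑ i, b i) := by
    rw [segment_eq_Icc (haq.trans hqb)]
    exact ⟨haq, hqb⟩
  obtain ⟨s, t, hs, ht, hst, rfl⟩ := hq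
  obtain rfl : s = 1 - t := by linarith
  refine ⟨fun i => (1 - t) * a i + t * b i, fun i => ⟨?_, ?_⟩, ?_⟩
  · nlinarith [mul_nonneg ht (sub_nonneg.2 (hab i))]
  · nlinarith [mul_nonneg hs (sub_nonneg.2 (hab i))]
  · simp [Finset.sum_add_distrib, Finset.mul_sum]

/-- The maximum of `∑ i, g i * δ i` over `C(Q)` equals `V(q*)`, where
`q* = min Q (∑_{i : 0 < g i} d i)` and `V(q)` is the maximum over the slice `S(q)`. -/
theorem stmt_10 (n : ℕ) (d : Fin n → ℝ) (hd : ∀ i, 0 < d i) (g : Fin n → ℝ)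
    (Q : ℝ) (hQ : 0 ≤ Q)
    (V : ℝ → ℝ)
    (hV : ∀ q ∈ Set.Icc (0 : ℝ) (∑ i, d i),
      IsGreatest {v : ℝ | ∃ δ : Fin n → ℝ,
        ((∑ i, δ i = q) ∧ ∀ i, 0 ≤ δ i ∧ δ i ≤ d i) ∧ v = ∑ i, g i * δ i} (V q))
    (qstar : ℝ)
    (hqstar : qstar = min Q (∑ i ∈ Finset.univ.filter (fun i => 0 < g i), d i)) :
    IsGreatest {v : ℝ | ∃ δ : Fin n → ℝ,
        ((∑ i, δ i ≤ Q) ∧ ∀ i, 0 ≤ δ i ∧ δ i ≤ d i) ∧ v = ∑ i, g i * δ i}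
      (V qstar) := by
  have hmem : qstar ∈ Set.Icc (0 : ℝ) (∑ i, d i) := by
    rw [hqstar]
    exact ⟨le_min hQ (Finset.sum_nonneg fun i _ => (hd i).le),
      (min_le_right _ _).trans (Finset.sum_le_sum_of_subset_of_nonneg (Finset.filter_subset _ _)
        fun i _ _ => (hd i).le)⟩
  obtain ⟨⟨δ₀, ⟨hsum₀, hbox₀⟩, hval₀⟩, hub⟩ := hV qstar hmem
  refine ⟨⟨δ₀, ⟨hsum₀.trans_le (hqstar ▸ min_le_left _ _), hbox₀⟩, hval₀⟩, ?_⟩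
  rintro v ⟨δ, ⟨hsum, hbox⟩, rfl⟩
  rw [Finset.sum_filter] at hqstar
  have hle : ∀ i, (if 0 < g i then δ i else 0) ≤ if 0 < g i then d i else 0 := by
    intro i
    split_ifs
    exacts [(hbox i).2, le_rfl]
  have hleδ : ∀ i, (if 0 < g i then δ i else 0) ≤ δ i := by
    intro i
    split_ifs
    exacts [le_rfl, (hbox i).1]
  have hlow : ∑ i, (if 0 < g i then δ i else 0) ≤ qstar := by
    rw [hqstar]
    exact le_min ((Finset.sum_le_sum fun i _ => hleδ i).trans hsum)
      (Finset.sum_le_sum fun i _ => hle i)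
  obtain ⟨c, hc, hcsum⟩ := exists_between_sum_eq hle hlow (hqstar ▸ min_le_right _ _)
  have hprofit : ∑ i, g i * δ i ≤ ∑ i, g i * c i := by
    refine Finset.sum_le_sum fun i _ => ?_
    have hci := hc i
    split_ifs at hci with hg
    · exact mul_le_mul_of_nonneg_left hci.1 hg.le
    · rw [le_antisymm hci.2 hci.1, mul_zero]
      exact mul_nonpos_of_nonpos_of_nonneg (not_lt.1 hg) (hbox i).1
  refine hprofit.trans (hub ⟨c, ⟨hcsum, fun i => ?_⟩, rfl⟩)
  have hci := hc i
  split_ifs at hci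
  · exact ⟨(hbox i).1.trans hci.1, hci.2⟩
  · exact ⟨hci.1, hci.2.trans (hd i).le⟩
end

section
/- For all reals a, b, Q, q̂, all m ≥ 1, all c : {1,…,m−1} → ℝ and δ, π, μ : {1,…,m} → ℝ satisfying ∑_{i=1}^{m} δ i = Q − q̂, the following identity holds: ∑_{i=1}^{m−1} c i * (a * (q̂ + ∑_{j=1}^{i} δ j) + b) − ∑_{i=1}^{m} (δ i * π i + μ i) = f^b − ∑_{i=1}^{m} δ i * g^b i, where f^b = (a * Q + b) * ∑_{i=1}^{m−1} c i − ∑_{i=1}^{m} μ i and g^b i = π i + a * ∑_{j=1}^{i−1} c j for 1 ≤ i ≤ m. (This is the decomposition of the reduced cost of a backward collection pattern, given incoming flow q̂ and total collected quantity Q − q̂, into a fixed cost f^b and a variable cost −∑ δ_i g^b_i.) -/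
/-- Summation by parts: splitting the product of two sums over `i`, `j` according to
whether `j ≤ i` or `i < j`. -/
theorem sum_mul_partial_sum_add_sum_mul_partial_sum {R : Type*} [CommRing R]
    (c δ : ℕ → R) (n : ℕ) :
    ∑ i ∈ Finset.Icc 1 n, c i * ∑ j ∈ Finset.Icc 1 i, δ j
        + ∑ i ∈ Finset.Icc 1 (n + 1), δ i * ∑ j ∈ Finset.Icc 1 (i - 1), c j
      = (∑ i ∈ Finset.Icc 1 n, c i) * ∑ i ∈ Finset.Icc 1 (n + 1), δ i := by
  induction n with
  | zero => simp
  | succ n ih =>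
    rw [Finset.sum_Icc_succ_top (by omega : 1 ≤ n + 1 + 1) δ,
      Finset.sum_Icc_succ_top (by omega : 1 ≤ n + 1 + 1),
      Finset.sum_Icc_succ_top (by omega : 1 ≤ n + 1), Nat.add_sub_cancel,
      Finset.sum_Icc_succ_top (by omega : 1 ≤ n + 1) c]
    linear_combination ih

/-- Decomposition of the reduced cost of a backward collection pattern, with incoming
flow `q̂` and total collected quantity `Q − q̂`, into a fixed cost
`f^b = (a·Q + b)·∑_{i=1}^{m−1} c i − ∑_{i=1}^{m} μ i` and a variable cost
`−∑_{i=1}^{m} δ i · g^b i`, where `g^b i = π i + a·∑_{j=1}^{i−1} c j`. -/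
theorem stmt_12 (a b Q qhat : ℝ) (m : ℕ) (hm : 1 ≤ m)
    (c δ π μ gb : ℕ → ℝ) (fb : ℝ)
    (hδ : ∑ i ∈ Finset.Icc 1 m, δ i = Q - qhat)
    (hfb : fb = (a * Q + b) * ∑ i ∈ Finset.Icc 1 (m - 1), c i
        - ∑ i ∈ Finset.Icc 1 m, μ i)
    (hgb : ∀ i, 1 ≤ i → i ≤ m →
      gb i = π i + a * ∑ j ∈ Finset.Icc 1 (i - 1), c j) :
    ∑ i ∈ Finset.Icc 1 (m - 1),
        c i * (a * (qhat + ∑ j ∈ Finset.Icc 1 i, δ j) + b)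
        - ∑ i ∈ Finset.Icc 1 m, (δ i * π i + μ i)
      = fb - ∑ i ∈ Finset.Icc 1 m, δ i * gb i := by
  obtain ⟨n, rfl⟩ : ∃ n, m = n + 1 := ⟨m - 1, by omega⟩
  rw [Nat.add_sub_cancel] at hfb ⊢
  have hcost : ∑ i ∈ Finset.Icc 1 n, c i * (a * (qhat + ∑ j ∈ Finset.Icc 1 i, δ j) + b)
      = (a * qhat + b) * ∑ i ∈ Finset.Icc 1 n, c i
        + a * ∑ i ∈ Finset.Icc 1 n, c i * ∑ j ∈ Finset.Icc 1 i, δ j := by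
    rw [Finset.mul_sum, Finset.mul_sum, ← Finset.sum_add_distrib]
    exact Finset.sum_congr rfl fun i _ => by ring
  have hvar : ∑ i ∈ Finset.Icc 1 (n + 1), δ i * gb i
      = ∑ i ∈ Finset.Icc 1 (n + 1), δ i * π i
        + a * ∑ i ∈ Finset.Icc 1 (n + 1), δ i * ∑ j ∈ Finset.Icc 1 (i - 1), c j := by
    rw [Finset.mul_sum, ← Finset.sum_add_distrib]
    refine Finset.sum_congr rfl fun i hi => ?_
    rw [hgb i (Finset.mem_Icc.mp hi).1 (Finset.mem_Icc.mp hi).2]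
    ring
  have hparts := sum_mul_partial_sum_add_sum_mul_partial_sum c δ n
  rw [hδ] at hparts
  rw [hcost, hvar, hfb, Finset.sum_add_distrib]
  linear_combination a * hparts
end

section
/- Consider two routes, route 1 with m₁ vertices and edge distances c¹, and route 2 with m₂ vertices and edge distances c², with collection quantities δ¹ and δ², and let cost₁, cost₂ denote their pattern costs cost(δ) = ∑_{i} c i * (a * (∑_{j≤i} δ j) + b). Let i₁ < j₁ be positions on route 1 and i₂ < j₂ positions on route 2, and ε ∈ ℝ. Then cost₁(δ¹ + ε·e_{i₁} − ε·e_{j₁}) + cost₂(δ² − ε·e_{i₂} + ε·e_{j₂}) = cost₁(δ¹) + cost₂(δ²) + a * ε * ( ∑_{t=i₁}^{j₁−1} c¹ t − ∑_{t=i₂}^{j₂−1} c² t ). (This is the exchange computation underlying Theorem 1: shifting ε units of collection from the later to the earlier common customer on route 1 and the reverse on route 2 changes the total cost by a·ε times the difference of the inter-customer distances along the two routes.) -/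
/-- Shifting `ε` units of collection from position `q` to an earlier position `p` of a route
changes its pattern cost by `a * ε` times the distance from `p` to `q`. -/
theorem pattern_cost_shift (a b : ℝ) (m : ℕ) (c δ : ℕ → ℝ) (p q : ℕ)
    (hp : 1 ≤ p) (hpq : p < q) (hq : q ≤ m) (ε : ℝ) :
    ∑ i ∈ Finset.Icc 1 (m - 1), c i * (a * (∑ j ∈ Finset.Icc 1 i,
        (δ j + (if j = p then ε else 0) - (if j = q then ε else 0))) + b) =
      ∑ i ∈ Finset.Icc 1 (m - 1), c i * (a * (∑ j ∈ Finset.Icc 1 i, δ j) + b) +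
        a * ε * ∑ t ∈ Finset.Icc p (q - 1), c t := by
  have hfilter : Finset.Icc p (q - 1) =
      (Finset.Icc 1 (m - 1)).filter (fun i => p ≤ i ∧ i < q) := by
    ext i
    simp only [Finset.mem_Icc, Finset.mem_filter]
    omega
  rw [hfilter, Finset.sum_filter, Finset.mul_sum, ← Finset.sum_add_distrib]
  refine Finset.sum_congr rfl fun i _ => ?_
  rw [Finset.sum_sub_distrib, Finset.sum_add_distrib, Finset.sum_ite_eq', Finset.sum_ite_eq']
  simp only [Finset.mem_Icc]
  split_ifs <;> first | omega | ring

/-- Exchange computation underlying Theorem 1: shifting `ε` units of collection from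
position `j₁` to position `i₁` on route 1 and from `i₂` to `j₂` on route 2 changes the
total pattern cost by `a·ε·(∑_{t=i₁}^{j₁−1} c¹ t − ∑_{t=i₂}^{j₂−1} c² t)`. -/
theorem stmt_14 (a b : ℝ)
    (m₁ m₂ : ℕ) (hm₁ : 1 ≤ m₁) (hm₂ : 1 ≤ m₂)
    (c₁ c₂ : ℕ → ℝ)
    (cost₁ cost₂ : (ℕ → ℝ) → ℝ)
    (hcost₁ : ∀ δ : ℕ → ℝ, cost₁ δ =
      ∑ i ∈ Finset.Icc 1 (m₁ - 1), c₁ i * (a * (∑ j ∈ Finset.Icc 1 i, δ j) + b))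
    (hcost₂ : ∀ δ : ℕ → ℝ, cost₂ δ =
      ∑ i ∈ Finset.Icc 1 (m₂ - 1), c₂ i * (a * (∑ j ∈ Finset.Icc 1 i, δ j) + b))
    (δ₁ δ₂ : ℕ → ℝ)
    (i₁ j₁ : ℕ) (hi₁ : 1 ≤ i₁) (hij₁ : i₁ < j₁) (hj₁ : j₁ ≤ m₁)
    (i₂ j₂ : ℕ) (hi₂ : 1 ≤ i₂) (hij₂ : i₂ < j₂) (hj₂ : j₂ ≤ m₂)
    (ε : ℝ) :
    cost₁ (fun t => δ₁ t + (if t = i₁ then ε else 0) - (if t = j₁ then ε else 0)) +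
      cost₂ (fun t => δ₂ t - (if t = i₂ then ε else 0) + (if t = j₂ then ε else 0))
      = cost₁ δ₁ + cost₂ δ₂ +
        a * ε * (∑ t ∈ Finset.Icc i₁ (j₁ - 1), c₁ t
          - ∑ t ∈ Finset.Icc i₂ (j₂ - 1), c₂ t) := by
  have hneg : (fun t => δ₂ t - (if t = i₂ then ε else 0) + (if t = j₂ then ε else 0)) =
      fun t => δ₂ t + (if t = i₂ then -ε else 0) - (if t = j₂ then -ε else 0) := by
    funext t
    split_ifs <;> ring
  rw [hneg, hcost₁, hcost₂, hcost₁ δ₁, hcost₂ δ₂,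
    pattern_cost_shift a b m₁ c₁ δ₁ i₁ j₁ hi₁ hij₁ hj₁ ε,
    pattern_cost_shift a b m₂ c₂ δ₂ i₂ j₂ hi₂ hij₂ hj₂ (-ε)]
  ring
end
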